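/- Let B ⊆ ℕ^m be a positive affine semigroup, let e₁, …, e_d ∈ B be linearly independent over ℚ with C({e₁,…,e_d}) = C(B), let A be the submonoid of B generated by e₁,…,e_d, set B_A := {x ∈ B : x ∉ B + (A ∖ {0})}, and set D_A := {x ∈ G(B) : x = λ₁e₁ + ⋯ + λ_d e_d with λ_i ∈ ℚ, 0 ≤ λ_i < 1 for all i}. Then C(B) ∩ G(B) ⊆ B if and only if B_A ⊆ D_A. -/

import Mathlib

open Pointwise

noncomputable section

/-- Coordinatewise cast `ℕ^m → ℚ^m`. -/
def natCastQ {m : ℕ} (x : Fin m → ℕ) : Fin m → ℚ := fun i => (x i : ℚ)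

/-- Coordinatewise cast `ℕ^m → ℤ^m`. -/
def natCastZ {m : ℕ} (x : Fin m → ℕ) : Fin m → ℤ := fun i => (x i : ℤ)

/-- Coordinatewise cast `ℤ^m → ℚ^m`. -/
def intCastQ {m : ℕ} (x : Fin m → ℤ) : Fin m → ℚ := fun i => (x i : ℚ)

/-- The rational convex cone spanned by a subset of `ℕ^m` inside `ℚ^m`. -/
def ratCone {m : ℕ} (X : Set (Fin m → ℕ)) : Set (Fin m → ℚ) :=
  {y | ∃ (k : ℕ) (q : Fin k → ℚ) (x : Fin k → (Fin m → ℕ)),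
    (∀ i, 0 ≤ q i) ∧ (∀ i, x i ∈ X) ∧ y = ∑ i, q i • natCastQ (x i)}

/-- `B_A = {x ∈ B : x ∉ B + (A ∖ {0})}`. -/
def BA {m : ℕ} (A B : AddSubmonoid (Fin m → ℕ)) : Set (Fin m → ℕ) :=
  {x | x ∈ B ∧ x ∉ (B : Set (Fin m → ℕ)) + ((A : Set (Fin m → ℕ)) \ {0})}

/-- The subgroup of `ℤ^m` generated by a subset of `ℕ^m`. -/
def grpZ {m : ℕ} (X : Set (Fin m → ℕ)) : AddSubgroup (Fin m → ℤ) :=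
  AddSubgroup.closure (natCastZ '' X)

/-- `D_A = {x ∈ G(B) : x = Σ λᵢ eᵢ, λᵢ ∈ ℚ, 0 ≤ λᵢ < 1}`, as a subset of `ℤ^m`. -/
def DAset {m d : ℕ} (B : AddSubmonoid (Fin m → ℕ)) (e : Fin d → (Fin m → ℕ)) :
    Set (Fin m → ℤ) :=
  {z | z ∈ grpZ (B : Set (Fin m → ℕ)) ∧ ∃ lam : Fin d → ℚ,
    (∀ i, 0 ≤ lam i ∧ lam i < 1) ∧ intCastQ z = ∑ i, lam i • natCastQ (e i)}

theorem natCastQ_zero {m : ℕ} : natCastQ (0 : Fin m → ℕ) = 0 := by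
  funext j; simp [natCastQ]

theorem natCastQ_add {m : ℕ} (x y : Fin m → ℕ) :
    natCastQ (x + y) = natCastQ x + natCastQ y := by
  funext j; simp [natCastQ]

theorem natCastQ_sum_nsmul {m d : ℕ} (n : Fin d → ℕ) (e : Fin d → Fin m → ℕ) :
    natCastQ (∑ i, n i • e i) = ∑ i, (n i : ℚ) • natCastQ (e i) := by
  funext j; simp [natCastQ, Finset.sum_apply]

theorem natCastQ_nsmul {m : ℕ} (n : ℕ) (x : Fin m → ℕ) :
    natCastQ (n • x) = (n : ℚ) • natCastQ x := by
  funext j; simp [natCastQ]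

theorem natCastQ_injective {m : ℕ} : Function.Injective (natCastQ (m := m)) := by
  intro x y h
  funext j
  exact Nat.cast_injective (congrFun h j)

theorem intCastQ_natCastZ {m : ℕ} (x : Fin m → ℕ) :
    intCastQ (natCastZ x) = natCastQ x := by
  funext j; simp [intCastQ, natCastZ, natCastQ]

theorem intCastQ_sub {m : ℕ} (x y : Fin m → ℤ) :
    intCastQ (x - y) = intCastQ x - intCastQ y := by
  funext j; simp [intCastQ]

theorem natCastZ_mem_grpZ {m : ℕ} {X : Set (Fin m → ℕ)} {x : Fin m → ℕ} (hx : x ∈ X) :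
    natCastZ x ∈ grpZ X :=
  AddSubgroup.subset_closure ⟨x, hx, rfl⟩

theorem natCastQ_mem_ratCone {m : ℕ} {X : Set (Fin m → ℕ)} {x : Fin m → ℕ} (hx : x ∈ X) :
    natCastQ x ∈ ratCone X :=
  ⟨1, fun _ => 1, fun _ => x, fun _ => zero_le_one, fun _ => hx, by simp⟩

theorem mem_ratCone_range_iff {m d : ℕ} {e : Fin d → Fin m → ℕ} {y : Fin m → ℚ} :
    y ∈ ratCone (Set.range e) ↔
      ∃ lam : Fin d → ℚ, (∀ i, 0 ≤ lam i) ∧ y = ∑ i, lam i • natCastQ (e i) := by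
  constructor
  · rintro ⟨k, q, x, hq, hx, rfl⟩
    choose f hf using hx
    refine ⟨fun i => ∑ j with f j = i, q j, fun i => Finset.sum_nonneg fun j _ => hq j, ?_⟩
    simp_rw [Finset.sum_smul, ← hf]
    rw [← Finset.sum_fiberwise Finset.univ f]
    refine Finset.sum_congr rfl fun i _ => Finset.sum_congr rfl fun j hj => ?_
    rw [(Finset.mem_filter.1 hj).2]
  · rintro ⟨lam, h, rfl⟩
    exact ⟨d, lam, e, h, fun i => ⟨i, rfl⟩, rfl⟩

theorem mem_closure_range_iff_sum_nsmul {m d : ℕ} {e : Fin d → Fin m → ℕ} {a : Fin m → ℕ} :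
    a ∈ AddSubmonoid.closure (Set.range e) ↔ ∃ n : Fin d → ℕ, a = ∑ i, n i • e i := by
  constructor
  · intro h
    induction h using AddSubmonoid.closure_induction with
    | mem x hx =>
      obtain ⟨i, rfl⟩ := hx
      exact ⟨Pi.single i 1, by simp [Pi.single_apply, ite_smul]⟩
    | zero => exact ⟨0, by simp⟩
    | add x y _ _ hx hy =>
      obtain ⟨n, rfl⟩ := hx
      obtain ⟨k, rfl⟩ := hy
      exact ⟨n + k, by simp [add_smul, Finset.sum_add_distrib]⟩
  · rintro ⟨n, rfl⟩
    exact sum_mem fun i _ => nsmul_mem (AddSubmonoid.subset_closure (Set.mem_range_self i)) _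

/-- Every element of `G(B)` is a difference of two elements of `B`. -/
theorem exists_sub_of_mem_grpZ {m : ℕ} {B : AddSubmonoid (Fin m → ℕ)} {z : Fin m → ℤ}
    (hz : z ∈ grpZ (B : Set (Fin m → ℕ))) :
    ∃ b ∈ B, ∃ c ∈ B, intCastQ z = natCastQ b - natCastQ c := by
  induction hz using AddSubgroup.closure_induction with
  | mem x hx =>
    obtain ⟨b, hb, rfl⟩ := hx
    exact ⟨b, hb, 0, B.zero_mem, by rw [intCastQ_natCastZ, natCastQ_zero, sub_zero]⟩
  | zero => exact ⟨0, B.zero_mem, 0, B.zero_mem, by funext j; simp [intCastQ]⟩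
  | add x y _ _ hx hy =>
    obtain ⟨b, hb, c, hc, h⟩ := hx
    obtain ⟨b', hb', c', hc', h'⟩ := hy
    refine ⟨b + b', B.add_mem hb hb', c + c', B.add_mem hc hc', ?_⟩
    have hxy : intCastQ (x + y) = intCastQ x + intCastQ y := by funext j; simp [intCastQ]
    rw [hxy, h, h', natCastQ_add, natCastQ_add]
    abel
  | neg x _ hx =>
    obtain ⟨b, hb, c, hc, h⟩ := hx
    refine ⟨c, hc, b, hb, ?_⟩
    have hneg : intCastQ (-x) = -intCastQ x := by funext j; simp [intCastQ]
    rw [hneg, h, neg_sub]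

/-- Every element of `B` is the sum of an element of `B_A` and an element of `A`. -/
theorem exists_add_of_mem {m : ℕ} {A B : AddSubmonoid (Fin m → ℕ)} {b : Fin m → ℕ}
    (hb : b ∈ B) : ∃ x ∈ BA A B, ∃ a ∈ A, b = x + a := by
  induction hN : ∑ j, b j using Nat.strong_induction_on generalizing b with
  | _ N ih =>
    by_cases hmem : b ∈ (B : Set (Fin m → ℕ)) + ((A : Set (Fin m → ℕ)) \ {0})
    · obtain ⟨c, hc, a, ⟨ha, ha0⟩, rfl⟩ := hmem
      have hlt : ∑ j, c j < N := by
        have hpos : 0 < ∑ j, a j := by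
          rw [Nat.pos_iff_ne_zero]
          intro h0
          apply ha0
          funext j
          simpa using Finset.sum_eq_zero_iff.1 h0 j (Finset.mem_univ j)
        rw [← hN]
        simp only [Pi.add_apply, Finset.sum_add_distrib]
        omega
      obtain ⟨x, hx, a', ha', rfl⟩ := ih _ hlt hc rfl
      exact ⟨x, hx, a' + a, A.add_mem ha' ha, add_assoc _ _ _⟩
    · exact ⟨b, ⟨hb, hmem⟩, 0, A.zero_mem, (add_zero b).symm⟩

/-- A natural point of the rational cone spanned by `e` has a positive multiple in the monoid
generated by `e`. -/
theorem exists_succ_nsmul_mem_closure {m d : ℕ} {e : Fin d → Fin m → ℕ} {x : Fin m → ℕ}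
    (hx : natCastQ x ∈ ratCone (Set.range e)) :
    ∃ k : ℕ, (k + 1) • x ∈ AddSubmonoid.closure (Set.range e) := by
  obtain ⟨lam, hlam, hsum⟩ := mem_ratCone_range_iff.1 hx
  have hD : ∏ i, (lam i).den ≠ 0 := Finset.prod_ne_zero_iff.2 fun i _ => (lam i).den_nz
  obtain ⟨k, hk⟩ := Nat.exists_eq_succ_of_ne_zero hD
  refine ⟨k, ?_⟩
  rw [← Nat.succ_eq_add_one, ← hk, mem_closure_range_iff_sum_nsmul]
  have hn : ∀ i, ∃ n : ℕ, ((∏ i, (lam i).den : ℕ) : ℚ) * lam i = n := by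
    intro i
    obtain ⟨c, hc⟩ := Finset.dvd_prod_of_mem (fun i => (lam i).den) (Finset.mem_univ i)
    refine ⟨c * (lam i).num.toNat, ?_⟩
    have hnum : (((lam i).num.toNat : ℕ) : ℚ) = (lam i).num := by
      exact_mod_cast Int.toNat_of_nonneg (Rat.num_nonneg.2 (hlam i))
    rw [hc]
    push_cast
    rw [hnum, ← Rat.mul_den_eq_num (lam i)]
    ring
  choose n hn using hn
  refine ⟨n, natCastQ_injective ?_⟩
  rw [natCastQ_nsmul, natCastQ_sum_nsmul, hsum, Finset.smul_sum]
  exact Finset.sum_congr rfl fun i _ => by rw [smul_smul, hn]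

/-- `C(B) ∩ G(B) ⊆ B` if and only if `B_A ⊆ D_A`. -/
theorem cone_cap_group_sub_iff {m d : ℕ}
    (B : AddSubmonoid (Fin m → ℕ)) (hB : B.FG)
    (e : Fin d → (Fin m → ℕ)) (he : ∀ i, e i ∈ B)
    (hind : LinearIndependent ℚ (fun i => natCastQ (e i)))
    (hcone : ratCone (Set.range e) = ratCone (B : Set (Fin m → ℕ)))
    (A : AddSubmonoid (Fin m → ℕ)) (hA : A = AddSubmonoid.closure (Set.range e))
    (hAB : A ≤ B) :
    (∀ y ∈ ratCone (B : Set (Fin m → ℕ)),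
        (∃ z ∈ grpZ (B : Set (Fin m → ℕ)), intCastQ z = y) →
        ∃ x ∈ B, natCastQ x = y) ↔
    ∀ x ∈ BA A B, natCastZ x ∈ DAset B e := by
  constructor
  · intro h x hx
    have hxG := natCastZ_mem_grpZ (X := (B : Set (Fin m → ℕ))) hx.1
    have hxC := natCastQ_mem_ratCone (X := (B : Set (Fin m → ℕ))) hx.1
    rw [← hcone] at hxC
    obtain ⟨lam, hlam, hsum⟩ := mem_ratCone_range_iff.1 hxC
    refine ⟨hxG, lam, fun i => ⟨hlam i, ?_⟩, by rw [intCastQ_natCastZ, hsum]⟩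
    by_contra! hi
    obtain ⟨y, hy, hyx⟩ := h (natCastQ x - natCastQ (e i))
      (by
        rw [← hcone, mem_ratCone_range_iff]
        refine ⟨lam - Pi.single i 1, fun j => ?_, ?_⟩
        · rcases eq_or_ne j i with rfl | hj
          · simpa using hi
          · simpa [hj] using hlam j
        · simp [sub_smul, Finset.sum_sub_distrib, Pi.single_apply, ite_smul, hsum])
      ⟨natCastZ x - natCastZ (e i), sub_mem hxG (natCastZ_mem_grpZ (he i)), by
        rw [intCastQ_sub, intCastQ_natCastZ, intCastQ_natCastZ]⟩
    refine hx.2 ⟨y, hy, e i, ⟨hA ▸ AddSubmonoid.subset_closure ⟨i, rfl⟩, fun h0 => ?_⟩, ?_⟩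
    · exact hind.ne_zero i (by rw [Set.mem_singleton_iff.1 h0, natCastQ_zero])
    · exact natCastQ_injective (by rw [natCastQ_add, hyx, sub_add_cancel])
  · rintro h y hyC ⟨z, hz, rfl⟩
    rw [← hcone] at hyC
    obtain ⟨lam, hlam, hlamz⟩ := mem_ratCone_range_iff.1 hyC
    obtain ⟨b, hb, c, hc, hbc⟩ := exists_sub_of_mem_grpZ hz
    have hcC := natCastQ_mem_ratCone (X := (B : Set (Fin m → ℕ))) hc
    rw [← hcone] at hcC
    obtain ⟨k, hk⟩ := exists_succ_nsmul_mem_closure hcC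
    obtain ⟨p, hp⟩ := mem_closure_range_iff_sum_nsmul.1 hk
    obtain ⟨x, hx, a, ha, hxa⟩ :=
      exists_add_of_mem (A := A) (B.add_mem hb (B.nsmul_mem hc k))
    rw [hA, mem_closure_range_iff_sum_nsmul] at ha
    obtain ⟨n, rfl⟩ := ha
    obtain ⟨-, mu, hmu, hmux⟩ := h x hx
    rw [intCastQ_natCastZ] at hmux
    have hxa' := congrArg natCastQ hxa
    have hp' := congrArg natCastQ hp
    rw [natCastQ_add, natCastQ_add, natCastQ_nsmul, natCastQ_sum_nsmul] at hxa'
    rw [natCastQ_nsmul, natCastQ_sum_nsmul, Nat.cast_succ, add_smul, one_smul] at hp'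
    have hzx : intCastQ z = natCastQ x +
        (∑ i, (n i : ℚ) • natCastQ (e i) - ∑ i, (p i : ℚ) • natCastQ (e i)) := by
      rw [hbc, ← hp', ← add_sub_assoc, ← hxa']
      abel
    have hcoef : ∀ i, lam i - (mu i + n i - p i) = 0 := by
      refine Fintype.linearIndependent_iff.1 hind _ ?_
      simp only [sub_smul, add_smul, Finset.sum_sub_distrib, Finset.sum_add_distrib]
      rw [← hlamz, ← hmux, hzx]
      abel
    have hle : ∀ i, p i ≤ n i := by
      intro i
      have hlt : (p i : ℚ) < n i + 1 := by linarith [hcoef i, hlam i, (hmu i).2]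
      exact Nat.lt_succ_iff.1 (by exact_mod_cast hlt)
    refine ⟨x + ∑ i, (n i - p i) • e i,
      B.add_mem hx.1 (sum_mem fun i _ => B.nsmul_mem (he i) _), ?_⟩
    rw [natCastQ_add, natCastQ_sum_nsmul, hzx, ← Finset.sum_sub_distrib]
    congr 1
    exact Finset.sum_congr rfl fun i _ => by rw [Nat.cast_sub (hle i), sub_smul]
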